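/- There exists a constant C₃ > 0 such that for every r > 1 and every f ∈ C_b^∞(ℝ^d), the local Poincaré inequality holds: ∫_{B(0,r)} ( f(x) − (μ_V(B(0,r)))^{−1} ∫_{B(0,r)} f dμ_V )² μ_V(dx) ≤ (C₃ K(r) r^{3d} / k(r)) · ∬_{B(0,r+1)×B(0,r+1)} (f(x)−f(y))² |x−y|^{−(d+α)} 𝟙_{{|x−y| ≤ 1}} dy μ_V(dx), and in particular the left-hand side is at most (C₃ K(r) r^{3d} / k(r)) · 𝓔_{α,V}(f,f). -/

import Mathlib

open MeasureTheory Real Set Metric Filter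

noncomputable section

/-- Euclidean space `ℝ^d`. -/
abbrev Ed (d : ℕ) := EuclideanSpace ℝ (Fin d)

/-- The probability measure `μ_V(dx) = C_V e^{-V(x)} dx` with `C_V = (∫ e^{-V})⁻¹`. -/
def muV (d : ℕ) (V : Ed d → ℝ) : Measure (Ed d) :=
  (volume : Measure (Ed d)).withDensity
    fun x => ENNReal.ofReal ((∫ y, Real.exp (-V y))⁻¹ * Real.exp (-V x))

/-- `f ∈ C_b^∞(ℝ^d)`: smooth with bounded derivatives of every order. -/
def CbSmooth (d : ℕ) (f : Ed d → ℝ) : Prop :=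
  ContDiff ℝ (⊤ : ℕ∞) f ∧ ∀ n : ℕ, ∃ C : ℝ, ∀ x, ‖iteratedFDeriv ℝ n f x‖ ≤ C

/-- `V` is locally bounded. -/
def LocallyBounded (d : ℕ) (V : Ed d → ℝ) : Prop :=
  ∀ r : ℝ, ∃ M : ℝ, ∀ x : Ed d, ‖x‖ ≤ r → |V x| ≤ M

/-- The nonlocal Dirichlet form with finite range jumps `𝓔_{α,V}`. -/
def formE (d : ℕ) (α : ℝ) (V f : Ed d → ℝ) : ℝ :=
  (1/2) * ∫ x, (∫ y in {y : Ed d | dist x y ≤ 1},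
      (f x - f y) ^ 2 / dist x y ^ ((d : ℝ) + α)) ∂(muV d V)

/-- The nonlocal Dirichlet form with large jumps `𝓓_{α,V}`. -/
def formD (d : ℕ) (α : ℝ) (V f : Ed d → ℝ) : ℝ :=
  (1/2) * ∫ x, (∫ y in {y : Ed d | 1 < dist x y},
      (f x - f y) ^ 2 / dist x y ^ ((d : ℝ) + α)) ∂(muV d V)

/-- `inf_{z : |x|-1 ≤ |z| ≤ |x|-1/2} e^{-V(z)}`. -/
def infAnn (d : ℕ) (V : Ed d → ℝ) (x : Ed d) : ℝ :=
  sInf ((fun z => Real.exp (-V z)) '' {z : Ed d | ‖x‖ - 1 ≤ ‖z‖ ∧ ‖z‖ ≤ ‖x‖ - 1/2})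

/-- `sup_{z : |x| ≤ |z| ≤ |x|+1} e^{-V(z)}`. -/
def supAnn (d : ℕ) (V : Ed d → ℝ) (x : Ed d) : ℝ :=
  sSup ((fun z => Real.exp (-V z)) '' {z : Ed d | ‖x‖ ≤ ‖z‖ ∧ ‖z‖ ≤ ‖x‖ + 1})

/-- `K(r) = sup_{|x| ≤ r} e^{-V(x)}`. -/
def Kfun (d : ℕ) (V : Ed d → ℝ) (r : ℝ) : ℝ :=
  sSup ((fun x => Real.exp (-V x)) '' {x : Ed d | ‖x‖ ≤ r})

/-- `k(r) = inf_{|x| ≤ r+1} e^{-V(x)}`. -/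
def kfun (d : ℕ) (V : Ed d → ℝ) (r : ℝ) : ℝ :=
  sInf ((fun x => Real.exp (-V x)) '' {x : Ed d | ‖x‖ ≤ r + 1})

/-- The constant `(1/α)·2^{2d+1}·(e + e^{1/2})·(2^α − 1)`. -/
def thresholdConst (d : ℕ) (α : ℝ) : ℝ :=
  (1/α) * (2:ℝ) ^ (2*d+1) * (Real.exp 1 + Real.exp (1/2)) * ((2:ℝ) ^ α - 1)

/-- Change of variables `(x, y) ↦ (x + t (y - x), x + (t + s) (y - x))`. -/
theorem lintegral_lintegral_segment {d : ℕ} {G : Ed d → Ed d → ENNReal}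
    (hG : Measurable (Function.uncurry G)) (t : ℝ) {s : ℝ} (hs : 0 < s) :
    ∫⁻ x, ∫⁻ y, G (x + t • (y - x)) (x + (t + s) • (y - x)) =
      ENNReal.ofReal ((s ^ d)⁻¹) * ∫⁻ x, ∫⁻ y, G x y := by
  have h1 : ∀ x : Ed d, ∫⁻ y, G (x + t • (y - x)) (x + (t + s) • (y - x)) =
      ∫⁻ w, G (x + t • w) (x + (t + s) • w) := fun x =>
    lintegral_sub_right_eq_self (fun w => G (x + t • w) (x + (t + s) • w)) x
  have h2 : ∀ w : Ed d, ∫⁻ x, G (x + t • w) (x + (t + s) • w) = ∫⁻ x, G x (x + s • w) := by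
    intro w
    rw [← lintegral_add_right_eq_self (fun x => G x (x + s • w)) (t • w)]
    simp only [add_smul, add_assoc]
  have h3 : ∀ x : Ed d, ∫⁻ w, G x (x + s • w) =
      ENNReal.ofReal ((s ^ d)⁻¹) * ∫⁻ y, G x y := by
    intro x
    have hm : Measurable fun w => G x (x + w) :=
      hG.comp (measurable_const.prodMk (measurable_const.add measurable_id))
    have hmap := Measure.map_addHaar_smul (volume : Measure (Ed d)) hs.ne'
    rw [← lintegral_map hm (measurable_const_smul s), hmap, lintegral_smul_measure,
      lintegral_add_left_eq_self (fun y => G x y) x, abs_of_pos (by positivity)]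
    simp
  calc ∫⁻ x, ∫⁻ y, G (x + t • (y - x)) (x + (t + s) • (y - x))
      = ∫⁻ x : Ed d, ∫⁻ w : Ed d, G (x + t • w) (x + (t + s) • w) := lintegral_congr h1
    _ = ∫⁻ w : Ed d, ∫⁻ x : Ed d, G (x + t • w) (x + (t + s) • w) := by
        refine lintegral_lintegral_swap (Measurable.aemeasurable ?_)
        exact hG.comp (f := fun p : Ed d × Ed d => (p.1 + t • p.2, p.1 + (t + s) • p.2))
          (by fun_prop)
    _ = ∫⁻ w : Ed d, ∫⁻ x : Ed d, G x (x + s • w) := lintegral_congr h2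
    _ = ∫⁻ x : Ed d, ∫⁻ w : Ed d, G x (x + s • w) := by
        refine lintegral_lintegral_swap (Measurable.aemeasurable ?_)
        exact hG.comp (f := fun p : Ed d × Ed d => (p.2, p.2 + s • p.1)) (by fun_prop)
    _ = _ := by
        rw [lintegral_congr h3, lintegral_const_mul]
        exact hG.lintegral_prod_right'

/-- The square of an increment is controlled by increments along a subdivided segment. -/
theorem sq_sub_le_sum_segment {d : ℕ} (f : Ed d → ℝ) (x y : Ed d) {N : ℕ} (hN : 0 < N) :
    (f x - f y) ^ 2 ≤ N * ∑ i ∈ Finset.range N,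
      (f (x + ((i : ℝ) / N) • (y - x)) - f (x + ((i : ℝ) / N + 1 / N) • (y - x))) ^ 2 := by
  have hN' : (N : ℝ) ≠ 0 := by positivity
  have h := Finset.sum_range_sub' (fun i : ℕ => f (x + ((i : ℝ) / N) • (y - x))) N
  simp only [Nat.cast_zero, zero_div, zero_smul, add_zero, div_self hN', one_smul,
    add_sub_cancel, Nat.cast_add, Nat.cast_one, add_div] at h
  rw [← h]
  simpa using sq_sum_le_card_mul_sum_sq (s := Finset.range N) (f := fun i : ℕ =>
    f (x + ((i : ℝ) / N) • (y - x)) - f (x + ((i : ℝ) / N + 1 / N) • (y - x)))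

/-- Increments over a ball are controlled by increments of length at most one. -/
theorem lintegral_lintegral_sq_sub_le {d : ℕ} {f : Ed d → ℝ} (hf : Measurable f) {r : ℝ}
    {N : ℕ} (hN : 0 < N) (hr : 2 * r ≤ N) :
    ∫⁻ x in ball (0 : Ed d) r, ∫⁻ y in ball (0 : Ed d) r, ENNReal.ofReal ((f x - f y) ^ 2) ≤
      ENNReal.ofReal ((N : ℝ) ^ (d + 2)) * ∫⁻ x in ball (0 : Ed d) r,
        ∫⁻ y in ball (0 : Ed d) r,
          ENNReal.ofReal (if dist x y ≤ 1 then (f x - f y) ^ 2 else 0) := by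
  set B := ball (0 : Ed d) r with hB
  have hBm : MeasurableSet B := measurableSet_ball
  have hN' : (0 : ℝ) < N := by exact_mod_cast hN
  let G : Ed d → Ed d → ENNReal := fun x y => B.indicator (fun x => B.indicator (fun y =>
    ENNReal.ofReal (if dist x y ≤ 1 then (f x - f y) ^ 2 else 0)) y) x
  have hG : Measurable (Function.uncurry G) := by
    have : Function.uncurry G = (B ×ˢ B).indicator (fun p : Ed d × Ed d =>
        ENNReal.ofReal (if dist p.1 p.2 ≤ 1 then (f p.1 - f p.2) ^ 2 else 0)) := by
      ext ⟨x, y⟩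
      by_cases hx : x ∈ B <;> by_cases hy : y ∈ B <;> simp [G, Function.uncurry, hx, hy]
    rw [this]
    refine Measurable.indicator (Measurable.ennreal_ofReal (Measurable.ite ?_ ?_ ?_)) (hBm.prod hBm)
    · exact measurableSet_le (by fun_prop) measurable_const
    · fun_prop
    · fun_prop
  have hGB : ∫⁻ x, ∫⁻ y, G x y = ∫⁻ x in B, ∫⁻ y in B,
      ENNReal.ofReal (if dist x y ≤ 1 then (f x - f y) ^ 2 else 0) := by
    rw [← lintegral_indicator hBm]
    refine lintegral_congr fun x => ?_
    by_cases hx : x ∈ B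
    · simp [G, hx, lintegral_indicator hBm]
    · simp [G, hx]
  let P : ℕ → Ed d → Ed d → ENNReal := fun i x y =>
    G (x + ((i : ℝ) / N) • (y - x)) (x + ((i : ℝ) / N + 1 / N) • (y - x))
  have hP : ∀ i, Measurable (Function.uncurry (P i)) := fun i =>
    hG.comp (f := fun p : Ed d × Ed d =>
      (p.1 + ((i : ℝ) / N) • (p.2 - p.1), p.1 + ((i : ℝ) / N + 1 / N) • (p.2 - p.1)))
      (by fun_prop)
  have hpt : ∀ x ∈ B, ∀ y ∈ B, ENNReal.ofReal ((f x - f y) ^ 2) ≤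
      (N : ENNReal) * ∑ i ∈ Finset.range N, P i x y := by
    intro x hx y hy
    refine (ENNReal.ofReal_le_ofReal (sq_sub_le_sum_segment f x y hN)).trans (le_of_eq ?_)
    rw [ENNReal.ofReal_mul hN'.le, ENNReal.ofReal_natCast,
      ENNReal.ofReal_sum_of_nonneg (fun _ _ => sq_nonneg _)]
    congr 1
    refine Finset.sum_congr rfl fun i hi => ?_
    have hi' : (i : ℝ) + 1 ≤ N := by exact_mod_cast Finset.mem_range.mp hi
    have hc : Convex ℝ B := convex_ball _ _
    have e : (i : ℝ) / N + 1 / N = (i + 1) / N := by ring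
    have hu : x + ((i : ℝ) / N) • (y - x) ∈ B := hc.add_smul_sub_mem hx hy
      ⟨by positivity, by rw [div_le_one hN']; linarith⟩
    have hv : x + ((i : ℝ) / N + 1 / N) • (y - x) ∈ B := hc.add_smul_sub_mem hx hy
      ⟨by positivity, by rw [e, div_le_one hN']; linarith⟩
    have hxy : dist x y ≤ N := by
      have := dist_triangle_right x y 0
      rw [hB, mem_ball] at hx hy
      linarith
    have hd : dist (x + ((i : ℝ) / N) • (y - x)) (x + ((i : ℝ) / N + 1 / N) • (y - x)) ≤ 1 := by
      rw [add_smul, ← add_assoc, dist_self_add_right, norm_smul, ← dist_eq_norm', Real.norm_eq_abs,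
        abs_of_pos (by positivity), one_div, inv_mul_le_iff₀ hN']
      simpa using hxy
    simp only [P, G, indicator_of_mem hu, indicator_of_mem hv, if_pos hd]
  calc ∫⁻ x in B, ∫⁻ y in B, ENNReal.ofReal ((f x - f y) ^ 2)
      ≤ ∫⁻ x in B, ∫⁻ y in B, (N : ENNReal) * ∑ i ∈ Finset.range N, P i x y :=
        setLIntegral_mono' hBm fun x hx => setLIntegral_mono' hBm fun y hy => hpt x hx y hy
    _ ≤ ∫⁻ x, ∫⁻ y, (N : ENNReal) * ∑ i ∈ Finset.range N, P i x y :=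
        (setLIntegral_le_lintegral _ _).trans (lintegral_mono fun x => setLIntegral_le_lintegral _ _)
    _ = N * ∑ i ∈ Finset.range N, ∫⁻ x, ∫⁻ y, P i x y := by
        have h1 : ∀ x, ∫⁻ y, (N : ENNReal) * ∑ i ∈ Finset.range N, P i x y =
            N * ∑ i ∈ Finset.range N, ∫⁻ y, P i x y := by
          intro x
          have hm : ∀ i, Measurable (P i x) := fun i => (hP i).of_uncurry_left
          rw [lintegral_const_mul _ (Finset.measurable_fun_sum _ fun i _ => hm i),
            lintegral_finsetSum _ fun i _ => hm i]
        have hm : ∀ i, Measurable fun x => ∫⁻ y, P i x y := fun i => (hP i).lintegral_prod_right'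
        rw [lintegral_congr h1, lintegral_const_mul _ (Finset.measurable_fun_sum _ fun i _ => hm i),
            lintegral_finsetSum _ fun i _ => hm i]
    _ = N * ∑ i ∈ Finset.range N, ENNReal.ofReal ((N : ℝ) ^ d) * ∫⁻ x, ∫⁻ y, G x y := by
        congr 1
        refine Finset.sum_congr rfl fun i _ => ?_
        rw [show (N : ℝ) ^ d = ((1 / (N : ℝ)) ^ d)⁻¹ by simp]
        exact lintegral_lintegral_segment hG _ (by positivity)
    _ = _ := by
        rw [hGB, Finset.sum_const, Finset.card_range, nsmul_eq_mul, pow_add,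
          ENNReal.ofReal_mul (by positivity), ENNReal.ofReal_pow hN'.le 2, ENNReal.ofReal_natCast]
        ring

theorem CbSmooth.exists_bound {d : ℕ} {f : Ed d → ℝ} (hf : CbSmooth d f) :
    ∃ C : ℝ, ∀ x, |f x| ≤ C := by
  obtain ⟨C, hC⟩ := hf.2 0
  exact ⟨C, fun x => by simpa using hC x⟩

theorem CbSmooth.exists_abs_sub_le {d : ℕ} {f : Ed d → ℝ} (hf : CbSmooth d f) :
    ∃ L : ℝ, ∀ x y, |f x - f y| ≤ L * dist x y := by
  obtain ⟨L, hL⟩ := hf.2 1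
  refine ⟨L, fun x y => ?_⟩
  rw [dist_eq_norm, ← Real.norm_eq_abs]
  exact convex_univ.norm_image_sub_le_of_norm_fderiv_le
    (fun z _ => (hf.1.differentiable (by simp)).differentiableAt)
    (fun z _ => by simpa only [norm_iteratedFDeriv_one] using hL z) (mem_univ y) (mem_univ x)

/-- The integrand of the finite range jump form. -/
def jumpKernel (d : ℕ) (α : ℝ) (f : Ed d → ℝ) (x y : Ed d) : ℝ :=
  if dist x y ≤ 1 then (f x - f y) ^ 2 / dist x y ^ ((d : ℝ) + α) else 0

theorem jumpKernel_nonneg {d : ℕ} {α : ℝ} (f : Ed d → ℝ) (x y : Ed d) :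
    0 ≤ jumpKernel d α f x y := by
  unfold jumpKernel
  split_ifs <;> positivity

theorem measurable_jumpKernel {d : ℕ} {α : ℝ} {f : Ed d → ℝ} (hf : Measurable f) :
    Measurable (Function.uncurry (jumpKernel d α f)) := by
  refine Measurable.ite (measurableSet_le (by fun_prop) measurable_const) ?_ measurable_const
  fun_prop

theorem sq_sub_le_jumpKernel {d : ℕ} {α : ℝ} (hα : 0 < α) (f : Ed d → ℝ) (x y : Ed d) :
    (if dist x y ≤ 1 then (f x - f y) ^ 2 else 0) ≤ jumpKernel d α f x y := by
  unfold jumpKernel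
  split_ifs with h
  · rcases eq_or_ne x y with rfl | hxy
    · simp
    · exact le_div_self (sq_nonneg _) (rpow_pos_of_pos (dist_pos.mpr hxy) _)
        (rpow_le_one dist_nonneg h (by positivity))
  · exact le_rfl

theorem integrable_indicator_norm_rpow {d : ℕ} (hd : 1 ≤ d) {α : ℝ} (hα : α < 2) :
    Integrable ((ball (0 : Ed d) 2).indicator fun z => ‖z‖ ^ (2 - ((d : ℝ) + α))) := by
  have : Nonempty (Fin d) := ⟨⟨0, hd⟩⟩
  rw [integrable_indicator_iff measurableSet_ball]
  refine (integrableOn_fun_norm_addHaar (volume : Measure (Ed d))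
    (f := fun s : ℝ => s ^ (2 - ((d : ℝ) + α)))).mpr ?_
  refine ((intervalIntegral.integrableOn_Ioo_rpow_iff (s := 1 - α) two_pos).mpr
    (by linarith)).congr_fun (fun s hs => ?_) measurableSet_Ioo
  simp only [finrank_euclideanSpace, Fintype.card_fin, smul_eq_mul]
  rw [← rpow_natCast, ← rpow_add hs.1, Nat.cast_sub hd]
  congr 1
  push_cast
  ring

theorem jumpKernel_le {d : ℕ} {α L : ℝ} {f : Ed d → ℝ}
    (hL : ∀ x y, |f x - f y| ≤ L * dist x y) (x y : Ed d) :
    jumpKernel d α f x y ≤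
      L ^ 2 * (ball (0 : Ed d) 2).indicator (fun z => ‖z‖ ^ (2 - ((d : ℝ) + α))) (y - x) := by
  unfold jumpKernel
  split_ifs with h
  · have hmem : y - x ∈ ball (0 : Ed d) 2 := by
      rw [mem_ball_zero_iff, ← dist_eq_norm']
      linarith
    rw [indicator_of_mem hmem, ← dist_eq_norm']
    rcases eq_or_ne x y with rfl | hxy
    · simp only [sub_self, ne_eq, OfNat.ofNat_ne_zero, not_false_eq_true, zero_pow, zero_div]
      positivity
    · have hpos := dist_pos.mpr hxy
      rw [rpow_sub hpos, ← mul_div_assoc]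
      gcongr
      rw [rpow_two, ← mul_pow, ← sq_abs]
      exact pow_le_pow_left₀ (abs_nonneg _) (hL x y) 2
  · exact mul_nonneg (sq_nonneg _) (indicator_nonneg (fun z _ => by positivity) _)

theorem integrable_jumpKernel {d : ℕ} (hd : 1 ≤ d) {α : ℝ} (hα : α < 2) {f : Ed d → ℝ}
    (hf : CbSmooth d f) (x : Ed d) : Integrable (jumpKernel d α f x) := by
  obtain ⟨L, hL⟩ := hf.exists_abs_sub_le
  refine (((integrable_indicator_norm_rpow hd hα).comp_sub_right x).const_mul (L ^ 2)).mono'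
    (measurable_jumpKernel hf.1.continuous.measurable).of_uncurry_left.aestronglyMeasurable
    (.of_forall fun y => ?_)
  rw [Real.norm_of_nonneg (jumpKernel_nonneg f x y)]
  exact jumpKernel_le hL x y

theorem integrable_integral_jumpKernel {d : ℕ} (hd : 1 ≤ d) {α : ℝ} (hα : α < 2)
    {f : Ed d → ℝ} (hf : CbSmooth d f) (μ : Measure (Ed d)) [IsFiniteMeasure μ] (S : Set (Ed d)) :
    Integrable (fun x => ∫ y in S, jumpKernel d α f x y) μ := by
  obtain ⟨L, hL⟩ := hf.exists_abs_sub_le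
  refine Integrable.of_bound (C := ∫ z : Ed d, L ^ 2 *
    (ball (0 : Ed d) 2).indicator (fun z => ‖z‖ ^ (2 - ((d : ℝ) + α))) z)
    ((measurable_jumpKernel
      hf.1.continuous.measurable).stronglyMeasurable.integral_prod_right.aestronglyMeasurable)
    (.of_forall fun x => ?_)
  rw [Real.norm_of_nonneg (integral_nonneg fun y => jumpKernel_nonneg f x y)]
  calc ∫ y in S, jumpKernel d α f x y ≤ ∫ y, jumpKernel d α f x y :=
        setIntegral_le_integral (integrable_jumpKernel hd hα hf x)
          (.of_forall fun y => jumpKernel_nonneg f x y)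
    _ ≤ ∫ y, L ^ 2 *
          (ball (0 : Ed d) 2).indicator (fun z => ‖z‖ ^ (2 - ((d : ℝ) + α))) (y - x) :=
        integral_mono (integrable_jumpKernel hd hα hf x)
          (((integrable_indicator_norm_rpow hd hα).comp_sub_right x).const_mul _)
          fun y => jumpKernel_le hL x y
    _ = _ := integral_sub_right_eq_self (fun z => L ^ 2 *
          (ball (0 : Ed d) 2).indicator (fun z => ‖z‖ ^ (2 - ((d : ℝ) + α))) z) x

/-- Among all constants, the mean minimises the mean square distance. -/
theorem integral_sq_sub_mean_le {Ω : Type*} [MeasurableSpace Ω] (ν : Measure Ω)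
    [IsFiniteMeasure ν] {f : Ω → ℝ} (hf : MemLp f 2 ν) (c : ℝ) :
    ∫ x, (f x - (ν univ).toReal⁻¹ * ∫ y, f y ∂ν) ^ 2 ∂ν ≤ ∫ x, (f x - c) ^ 2 ∂ν := by
  rcases eq_or_ne ν 0 with rfl | hν
  · simp
  have hp : 0 < (ν univ).toReal :=
    ENNReal.toReal_pos (by simpa using hν) (measure_ne_top ν _)
  have hexp : ∀ a : ℝ, ∫ x, (f x - a) ^ 2 ∂ν =
      ∫ x, f x ^ 2 ∂ν - 2 * a * ∫ x, f x ∂ν + (ν univ).toReal * a ^ 2 := by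
    intro a
    have h1 : Integrable (fun x => 2 * a * f x) ν := (hf.integrable one_le_two).const_mul _
    have h2 : Integrable (fun x => f x ^ 2) ν := hf.integrable_sq
    have e : ∀ x, (f x - a) ^ 2 = (f x ^ 2 - 2 * a * f x) + a ^ 2 := fun x => by ring
    simp_rw [e]
    rw [integral_add (f := fun x => f x ^ 2 - 2 * a * f x) (h2.sub h1) (integrable_const _), integral_sub h2 h1, integral_const_mul,
      integral_const, smul_eq_mul, Measure.real]
  rw [hexp, hexp]
  set p := (ν univ).toReal
  set I := ∫ x, f x ∂ν
  have : 0 ≤ p * (c - p⁻¹ * I) ^ 2 := by positivity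
  have e : p * (c - p⁻¹ * I) ^ 2 = (-2 * c * I + p * c ^ 2) -
      (-2 * (p⁻¹ * I) * I + p * (p⁻¹ * I) ^ 2) := by
    field_simp
    ring
  linarith

theorem LocallyBounded.bddAbove_exp_neg {d : ℕ} {V : Ed d → ℝ} (hV : LocallyBounded d V)
    (r : ℝ) : BddAbove ((fun x => Real.exp (-V x)) '' {x : Ed d | ‖x‖ ≤ r}) := by
  obtain ⟨M, hM⟩ := hV r
  refine ⟨Real.exp M, ?_⟩
  rintro _ ⟨x, hx, rfl⟩
  exact exp_le_exp.mpr (by linarith [neg_abs_le (V x), hM x hx])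

theorem LocallyBounded.exp_neg_le_Kfun {d : ℕ} {V : Ed d → ℝ} (hV : LocallyBounded d V)
    {r : ℝ} {x : Ed d} (hx : ‖x‖ ≤ r) : Real.exp (-V x) ≤ Kfun d V r :=
  le_csSup (hV.bddAbove_exp_neg r) ⟨x, hx, rfl⟩

theorem kfun_le_exp_neg {d : ℕ} {V : Ed d → ℝ} {r : ℝ} {x : Ed d} (hx : ‖x‖ ≤ r + 1) :
    kfun d V r ≤ Real.exp (-V x) :=
  csInf_le ⟨0, by rintro _ ⟨y, -, rfl⟩; positivity⟩ ⟨x, hx, rfl⟩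

theorem LocallyBounded.kfun_pos {d : ℕ} {V : Ed d → ℝ} (hV : LocallyBounded d V) {r : ℝ}
    (hr : 0 ≤ r) : 0 < kfun d V r := by
  obtain ⟨M, hM⟩ := hV (r + 1)
  refine (Real.exp_pos (-M)).trans_le (le_csInf ⟨_, 0, ?_, rfl⟩ ?_)
  · simp only [mem_ofPred_eq, norm_zero]
    linarith
  · rintro _ ⟨x, hx, rfl⟩
    exact exp_le_exp.mpr (by linarith [le_abs_self (V x), hM x hx])

theorem isFiniteMeasure_muV {d : ℕ} {V : Ed d → ℝ}
    (hV : Integrable (fun x => Real.exp (-V x))) : IsFiniteMeasure (muV d V) :=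
  isFiniteMeasure_withDensity_ofReal (hV.const_mul _).2

theorem setLIntegral_muV {d : ℕ} {V : Ed d → ℝ} (hV : Measurable V) {S : Set (Ed d)}
    (hS : MeasurableSet S) {F : Ed d → ENNReal} (hF : Measurable F) :
    ∫⁻ x in S, F x ∂(muV d V) =
      ∫⁻ x in S, ENNReal.ofReal ((∫ y, Real.exp (-V y))⁻¹ * Real.exp (-V x)) * F x :=
  setLIntegral_withDensity_eq_setLIntegral_mul _ (by fun_prop) hF hS

theorem setLIntegral_muV_le {d : ℕ} {V : Ed d → ℝ} (hV : Measurable V)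
    (hVloc : LocallyBounded d V) {r : ℝ} {F : Ed d → ENNReal} (hF : Measurable F) :
    ∫⁻ x in ball (0 : Ed d) r, F x ∂(muV d V) ≤
      ENNReal.ofReal ((∫ y, Real.exp (-V y))⁻¹ * Kfun d V r) * ∫⁻ x in ball (0 : Ed d) r, F x := by
  rw [setLIntegral_muV hV measurableSet_ball hF, ← lintegral_const_mul _ hF]
  refine setLIntegral_mono' measurableSet_ball fun x hx => ?_
  have := hVloc.exp_neg_le_Kfun (mem_ball_zero_iff.mp hx).le
  have h0 : 0 ≤ ∫ y, Real.exp (-V y) := integral_nonneg fun y => (Real.exp_pos _).le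
  gcongr

theorem le_setLIntegral_muV {d : ℕ} {V : Ed d → ℝ} (hV : Measurable V) {r : ℝ}
    {F : Ed d → ENNReal} (hF : Measurable F) :
    ENNReal.ofReal ((∫ y, Real.exp (-V y))⁻¹ * kfun d V r) *
        ∫⁻ x in ball (0 : Ed d) (r + 1), F x ≤
      ∫⁻ x in ball (0 : Ed d) (r + 1), F x ∂(muV d V) := by
  rw [setLIntegral_muV hV measurableSet_ball hF, ← lintegral_const_mul _ hF]
  refine setLIntegral_mono' measurableSet_ball fun x hx => ?_
  have := kfun_le_exp_neg (V := V) (mem_ball_zero_iff.mp hx).le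
  have h0 : 0 ≤ ∫ y, Real.exp (-V y) := integral_nonneg fun y => (Real.exp_pos _).le
  gcongr

/-- The jump energy over a ball dominates the unweighted truncated energy. -/
theorem lintegral_truncated_le_jumpKernel {d : ℕ} (hd : 1 ≤ d) {α : ℝ} (hα : 0 < α ∧ α < 2)
    {V : Ed d → ℝ} (hV : Measurable V) (hVint : Integrable (fun x => Real.exp (-V x)))
    {f : Ed d → ℝ} (hf : CbSmooth d f) (r : ℝ) :
    ENNReal.ofReal ((∫ y, Real.exp (-V y))⁻¹ * kfun d V r) *
        (∫⁻ x in ball (0 : Ed d) r, ∫⁻ y in ball (0 : Ed d) r,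
          ENNReal.ofReal (if dist x y ≤ 1 then (f x - f y) ^ 2 else 0)) ≤
      ENNReal.ofReal (∫ x in ball (0 : Ed d) (r + 1), (∫ y in ball (0 : Ed d) (r + 1),
        jumpKernel d α f x y) ∂(muV d V)) := by
  have := isFiniteMeasure_muV hVint
  have hsub : ball (0 : Ed d) r ⊆ ball 0 (r + 1) := ball_subset_ball (by linarith)
  have hJ := measurable_jumpKernel (α := α) hf.1.continuous.measurable
  have hI : ∀ x, ENNReal.ofReal (∫ y in ball (0 : Ed d) (r + 1), jumpKernel d α f x y) =
      ∫⁻ y in ball (0 : Ed d) (r + 1), ENNReal.ofReal (jumpKernel d α f x y) := fun x =>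
    ofReal_integral_eq_lintegral_ofReal (integrable_jumpKernel hd hα.2 hf x).integrableOn
      (.of_forall fun y => jumpKernel_nonneg f x y)
  rw [ofReal_integral_eq_lintegral_ofReal
    (integrable_integral_jumpKernel hd hα.2 hf _ _)
    (.of_forall fun x => integral_nonneg fun y => jumpKernel_nonneg f x y)]
  simp_rw [hI]
  refine le_trans ?_ (le_setLIntegral_muV hV hJ.ennreal_ofReal.lintegral_prod_right')
  refine mul_le_mul_right ?_ _
  refine (lintegral_mono_set hsub).trans (lintegral_mono fun x => ?_)
  refine (lintegral_mono_set hsub).trans (lintegral_mono fun y => ?_)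
  exact ENNReal.ofReal_le_ofReal (sq_sub_le_jumpKernel hα.1 f x y)

/-- The variance over a ball is controlled by the unweighted double integral of increments. -/
theorem variance_ball_le {d : ℕ} {V : Ed d → ℝ} (hV : Measurable V)
    (hVloc : LocallyBounded d V) (hVint : Integrable (fun x => Real.exp (-V x)))
    {f : Ed d → ℝ} (hf : CbSmooth d f) {r : ℝ} (hr : 0 < r) :
    ENNReal.ofReal (∫ x in ball (0 : Ed d) r,
        (f x - (muV d V (ball (0 : Ed d) r)).toReal⁻¹ *
          ∫ y in ball (0 : Ed d) r, f y ∂(muV d V)) ^ 2 ∂(muV d V)) ≤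
      ENNReal.ofReal ((∫ y, Real.exp (-V y))⁻¹ * Kfun d V r) *
        ((∫⁻ x in ball (0 : Ed d) r, ∫⁻ y in ball (0 : Ed d) r,
          ENNReal.ofReal ((f x - f y) ^ 2)) / volume (ball (0 : Ed d) r)) := by
  have := isFiniteMeasure_muV hVint
  have hfm : Measurable f := hf.1.continuous.measurable
  obtain ⟨C, hC⟩ := hf.exists_bound
  have hL : ∀ c : ℝ, MemLp (fun x => f x - c) 2 ((muV d V).restrict (ball 0 r)) := fun c =>
    MemLp.of_bound (by fun_prop) (C + |c|) (.of_forall fun x =>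
      (abs_sub _ _).trans (by linarith [hC x]))
  have hm : Measurable fun y => ∫⁻ x in ball (0 : Ed d) r, ENNReal.ofReal ((f y - f x) ^ 2) :=
    Measurable.lintegral_prod_right'
      (f := fun p : Ed d × Ed d => ENNReal.ofReal ((f p.1 - f p.2) ^ 2)) (by fun_prop)
  obtain ⟨y, -, hy⟩ := exists_le_setLAverage (measure_ball_pos volume (0 : Ed d) hr).ne'
    measure_ball_lt_top.ne hm.aemeasurable
  rw [setLAverage_eq] at hy
  have hmean := integral_sq_sub_mean_le ((muV d V).restrict (ball 0 r))
    (by simpa using hL 0) (f y)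
  rw [Measure.restrict_apply_univ] at hmean
  calc _ ≤ ENNReal.ofReal (∫ x in ball (0 : Ed d) r, (f x - f y) ^ 2 ∂(muV d V)) :=
        ENNReal.ofReal_le_ofReal hmean
    _ = ∫⁻ x in ball (0 : Ed d) r, ENNReal.ofReal ((f y - f x) ^ 2) ∂(muV d V) := by
        rw [ofReal_integral_eq_lintegral_ofReal (hL _).integrable_sq
          (.of_forall fun x => sq_nonneg _)]
        simp_rw [sub_sq_comm (f y)]
    _ ≤ _ := setLIntegral_muV_le hV hVloc (by fun_prop)
    _ ≤ _ := by gcongr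

/-- The local Poincaré inequality with constant `3 ^ (d + 2) / |B(0, 1)|`. -/
theorem local_poincare_jumpKernel {d : ℕ} (hd : 1 ≤ d) {α : ℝ} (hα : 0 < α ∧ α < 2)
    {V : Ed d → ℝ} (hV : Measurable V) (hVloc : LocallyBounded d V)
    (hVint : Integrable (fun x => Real.exp (-V x))) {r : ℝ} (hr : 1 < r) {f : Ed d → ℝ}
    (hf : CbSmooth d f) :
    (∫ x in ball (0 : Ed d) r,
        (f x - (muV d V (ball (0 : Ed d) r)).toReal⁻¹ *
          ∫ y in ball (0 : Ed d) r, f y ∂(muV d V)) ^ 2 ∂(muV d V)) ≤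
      3 ^ (d + 2) / volume.real (ball (0 : Ed d) 1) * Kfun d V r * r ^ (3 * d) / kfun d V r *
        ∫ x in ball (0 : Ed d) (r + 1), (∫ y in ball (0 : Ed d) (r + 1),
          jumpKernel d α f x y) ∂(muV d V) := by
  have : Nonempty (Fin d) := ⟨⟨0, hd⟩⟩
  have hr0 : 0 < r := by linarith
  have hk := hVloc.kfun_pos hr0.le
  have hK : 0 < Kfun d V r :=
    (Real.exp_pos _).trans_le (hVloc.exp_neg_le_Kfun (x := 0) (by simpa using hr0.le))
  have hc : 0 < (∫ y, Real.exp (-V y))⁻¹ := inv_pos.mpr (integral_exp_pos hVint)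
  set c := (∫ y, Real.exp (-V y))⁻¹
  have hω : 0 < volume.real (ball (0 : Ed d) 1) :=
    ENNReal.toReal_pos (measure_ball_pos _ _ one_pos).ne' measure_ball_lt_top.ne
  set ω := volume.real (ball (0 : Ed d) 1) with hωdef
  have hvol : volume (ball (0 : Ed d) r) = ENNReal.ofReal (r ^ d * ω) := by
    rw [Measure.addHaar_ball _ _ hr0.le, finrank_euclideanSpace, Fintype.card_fin,
      ENNReal.ofReal_mul (by positivity), hωdef, ofReal_measureReal measure_ball_lt_top.ne]
  obtain ⟨N, hN, hrN, hN3⟩ : ∃ N : ℕ, 0 < N ∧ 2 * r ≤ N ∧ (N : ℝ) ≤ 3 * r :=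
    ⟨⌈2 * r⌉₊, Nat.ceil_pos.mpr (by linarith), Nat.le_ceil _,
      by linarith [Nat.ceil_lt_add_one (show 0 ≤ 2 * r by linarith)]⟩
  have h1 := variance_ball_le hV hVloc hVint hf hr0
  have h2 := lintegral_lintegral_sq_sub_le hf.1.continuous.measurable hN hrN
  have h3 := lintegral_truncated_le_jumpKernel hd hα hV hVint hf r
  set J := ∫ x in ball (0 : Ed d) (r + 1), (∫ y in ball (0 : Ed d) (r + 1),
    jumpKernel d α f x y) ∂(muV d V)
  have hJ : 0 ≤ J := integral_nonneg fun x => integral_nonneg fun y => jumpKernel_nonneg f x y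
  set D := ∫⁻ x in ball (0 : Ed d) r, ∫⁻ y in ball (0 : Ed d) r,
    ENNReal.ofReal (if dist x y ≤ 1 then (f x - f y) ^ 2 else 0)
  have h3' : D ≤ ENNReal.ofReal (J / (c * kfun d V r)) := by
    rw [ENNReal.ofReal_div_of_pos (by positivity), ENNReal.le_div_iff_mul_le
      (.inl (ENNReal.ofReal_pos.mpr (by positivity)).ne') (.inl ENNReal.ofReal_ne_top), mul_comm]
    exact h3
  have h4 := h1.trans (mul_le_mul_right (ENNReal.div_le_div_right (h2.trans
    (mul_le_mul_right h3' _)) _) _)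
  rw [hvol, ← ENNReal.ofReal_mul (by positivity), ← ENNReal.ofReal_div_of_pos (by positivity),
    ← ENNReal.ofReal_mul (by positivity), ENNReal.ofReal_le_ofReal_iff (by positivity)] at h4
  have hpow : (N : ℝ) ^ (d + 2) ≤ 3 ^ (d + 2) * (r ^ d * r ^ (3 * d)) := by
    calc (N : ℝ) ^ (d + 2) ≤ (3 * r) ^ (d + 2) := by gcongr
      _ = 3 ^ (d + 2) * (r ^ d * r ^ 2) := by ring
      _ ≤ _ := by
        gcongr
        · exact hr.le
        · omega
  calc _ ≤ _ := h4
    _ ≤ c * Kfun d V r * (3 ^ (d + 2) * (r ^ d * r ^ (3 * d)) * (J / (c * kfun d V r)) /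
          (r ^ d * ω)) := by gcongr
    _ = _ := by field_simp

theorem integral_jumpKernel_ball_le_formE {d : ℕ} (hd : 1 ≤ d) {α : ℝ} (hα : α < 2)
    {V : Ed d → ℝ} (hVint : Integrable (fun x => Real.exp (-V x))) {f : Ed d → ℝ}
    (hf : CbSmooth d f) (S : Set (Ed d)) :
    ∫ x in S, (∫ y in S, jumpKernel d α f x y) ∂(muV d V) ≤ 2 * formE d α V f := by
  have := isFiniteMeasure_muV hVint
  have hE : 2 * formE d α V f = ∫ x, (∫ y in univ, jumpKernel d α f x y) ∂(muV d V) := by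
    unfold formE
    rw [← mul_assoc, mul_one_div_cancel two_ne_zero, one_mul]
    refine integral_congr_ae (.of_forall fun x => ?_)
    have hS : MeasurableSet {y : Ed d | dist x y ≤ 1} :=
      measurableSet_le (by fun_prop) measurable_const
    simp only [Measure.restrict_univ]
    rw [← integral_indicator hS]
    rfl
  rw [hE]
  refine (integral_mono (integrable_integral_jumpKernel hd hα hf _ S)
    (integrable_integral_jumpKernel hd hα hf _ univ) fun x => ?_).trans
    (setIntegral_le_integral (integrable_integral_jumpKernel hd hα hf _ univ)
      (.of_forall fun x => integral_nonneg fun y => jumpKernel_nonneg f x y))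
  simp only [Measure.restrict_univ]
  exact setIntegral_le_integral (integrable_jumpKernel hd hα hf x)
    (.of_forall fun y => jumpKernel_nonneg f x y)

/-- local Poincaré inequality for `𝓔_{α,V}` on balls. -/
theorem local_poincare_formE
    (d : ℕ) (hd : 1 ≤ d) (α : ℝ) (hα : 0 < α ∧ α < 2)
    (V : Ed d → ℝ) (hVmeas : Measurable V) (hVloc : LocallyBounded d V)
    (hVint : Integrable (fun x => Real.exp (-V x))) :
    ∃ C₃ : ℝ, 0 < C₃ ∧ ∀ r : ℝ, 1 < r → ∀ f : Ed d → ℝ, CbSmooth d f →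
      (∫ x in ball (0 : Ed d) r,
          (f x - (muV d V (ball (0 : Ed d) r)).toReal⁻¹ *
            ∫ y in ball (0 : Ed d) r, f y ∂(muV d V)) ^ 2 ∂(muV d V)) ≤
        C₃ * Kfun d V r * r ^ (3*d) / kfun d V r *
          (∫ x in ball (0 : Ed d) (r+1), (∫ y in ball (0 : Ed d) (r+1),
              (if dist x y ≤ 1 then (f x - f y) ^ 2 / dist x y ^ ((d:ℝ) + α) else 0))
            ∂(muV d V)) ∧
      (∫ x in ball (0 : Ed d) r,
          (f x - (muV d V (ball (0 : Ed d) r)).toReal⁻¹ *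
            ∫ y in ball (0 : Ed d) r, f y ∂(muV d V)) ^ 2 ∂(muV d V)) ≤
        C₃ * Kfun d V r * r ^ (3*d) / kfun d V r * formE d α V f := by
  have hω : 0 < volume.real (ball (0 : Ed d) 1) :=
    ENNReal.toReal_pos (measure_ball_pos _ _ one_pos).ne' measure_ball_lt_top.ne
  refine ⟨2 * (3 ^ (d + 2) / volume.real (ball (0 : Ed d) 1)), by positivity,
    fun r hr f hf => ?_⟩
  have hk := hVloc.kfun_pos (zero_le_one.trans hr.le)
  have hK : 0 < Kfun d V r := (Real.exp_pos _).trans_le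
    (hVloc.exp_neg_le_Kfun (x := 0) (by simpa using zero_le_one.trans hr.le))
  have h1 := local_poincare_jumpKernel hd hα hVmeas hVloc hVint hr hf
  have h2 := integral_jumpKernel_ball_le_formE hd hα.2 hVint hf (ball 0 (r + 1))
  have hJ : 0 ≤ ∫ x in ball (0 : Ed d) (r + 1), (∫ y in ball (0 : Ed d) (r + 1),
      jumpKernel d α f x y) ∂(muV d V) :=
    integral_nonneg fun x => integral_nonneg fun y => jumpKernel_nonneg f x y
  have hC : 0 ≤ 3 ^ (d + 2) / volume.real (ball (0 : Ed d) 1) * Kfun d V r * r ^ (3 * d) /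
      kfun d V r := by positivity
  have e : 2 * (3 ^ (d + 2) / volume.real (ball (0 : Ed d) 1)) * Kfun d V r * r ^ (3 * d) /
      kfun d V r = 2 * (3 ^ (d + 2) / volume.real (ball (0 : Ed d) 1) * Kfun d V r *
        r ^ (3 * d) / kfun d V r) := by ring
  rw [e]
  refine ⟨h1.trans (mul_le_mul_of_nonneg_right (by linarith) hJ), h1.trans ?_⟩
  exact (mul_le_mul_of_nonneg_left h2 hC).trans_eq (by ring)
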